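/- arXiv:2509.05600 — 5 statements merged into one kernel-verified Lean document; each statement's English description precedes it below -/
import Mathlib

section
/- Cardinality of the representation sets Σ_ξ: for each ξ ∈ F_q⁴, |Σ_ξ| = (q+1)²(q−1) if ξ = 0; |Σ_ξ| = 2q²−q−2 if ξ ∈ Γ³; and |Σ_ξ| = q²+q if ξ ∉ Γ³ ∪ {0}. -/
open Finset

noncomputable section

/-- The punctured cone `Γ³ = {η ∈ F_q⁴ \ {0} : η₁η₂ = η₃η₄}`. -/
def coneM (F : Type) [Field F] [Fintype F] [DecidableEq F] : Finset (Fin 4 → F) :=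
  univ.filter fun η => η ≠ 0 ∧ η 0 * η 1 = η 2 * η 3

/-- The representation set `Σ_ξ = {(η,ρ) ∈ Γ³ × Γ³ : η + ρ = ξ}`. -/
def sigmaSet (F : Type) [Field F] [Fintype F] [DecidableEq F] (ξ : Fin 4 → F) :
    Finset ((Fin 4 → F) × (Fin 4 → F)) :=
  ((coneM F) ×ˢ (coneM F)).filter fun pr => pr.1 + pr.2 = ξ

lemma aux_lin {F : Type} [Field F] [Fintype F] [DecidableEq F] (k u : F) :
    (∑ v : F, if u * v = k then (1:ℕ) else 0) =
      if u = 0 then (if k = 0 then Fintype.card F else 0) else 1 := by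
  by_cases hu : u = 0
  · subst hu
    by_cases hk : k = 0
    · simp [hk]
    · simp [hk, Ne.symm hk]
  · have : ∀ v : F, (u * v = k) ↔ v = u⁻¹ * k := by
      intro v
      constructor
      · rintro rfl; field_simp
      · rintro rfl; field_simp
    simp [this, hu]

lemma aux_K {F : Type} [Field F] [Fintype F] [DecidableEq F] (k : F) :
    (∑ u : F, ∑ v : F, if u * v = k then (1:ℕ) else 0) =
      (Fintype.card F - 1) + if k = 0 then Fintype.card F else 0 := by
  simp_rw [aux_lin]
  rw [← Finset.add_sum_erase _ _ (Finset.mem_univ (0:F))]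
  rw [Finset.sum_congr rfl (g := fun _ => (1:ℕ))]
  · simp [Finset.card_erase_of_mem, Finset.card_univ]; ring
  · intro x hx
    simp [Finset.ne_of_mem_erase hx]

lemma aux_T0 {F : Type} [Field F] [Fintype F] [DecidableEq F] (a D : F) (hD : D = 0) :
    (univ.filter fun t : F × F × F => t.2.1 * t.2.2 = D * t.1 * (a - t.1)).card =
      Fintype.card F * ((Fintype.card F - 1) + Fintype.card F) := by
  rw [Finset.card_filter]
  simp_rw [Fintype.sum_prod_type, aux_K]
  simp [hD, Finset.card_univ]

lemma aux_T1 {F : Type} [Field F] [Fintype F] [DecidableEq F] (a D : F) (ha : a ≠ 0) (hD : D ≠ 0) :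
    (univ.filter fun t : F × F × F => t.2.1 * t.2.2 = D * t.1 * (a - t.1)).card =
      Fintype.card F * (Fintype.card F - 1) + 2 * Fintype.card F := by
  rw [Finset.card_filter]
  simp_rw [Fintype.sum_prod_type, aux_K]
  rw [Finset.sum_add_distrib, ← Finset.sum_filter]
  have : (univ.filter fun x : F => D * x * (a - x) = 0) = {0, a} := by
    ext x
    simp [hD, sub_eq_zero, eq_comm]
  rw [this]
  simp [Finset.card_univ, Finset.card_pair ha.symm]

def auxS (F : Type) [Field F] [Fintype F] [DecidableEq F] (ξ : Fin 4 → F) : Finset (Fin 4 → F) :=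
  univ.filter fun η => η 0 * η 1 = η 2 * η 3 ∧ 
    (ξ 0 - η 0) * (ξ 1 - η 1) = (ξ 2 - η 2) * (ξ 3 - η 3)

lemma aux_S {F : Type} [Field F] [Fintype F] [DecidableEq F] (ξ : Fin 4 → F) (ha : ξ 0 ≠ 0) :
    (auxS F ξ).card = (univ.filter fun t : F × F × F => t.2.1 * t.2.2 =
      (ξ 0 * ξ 1 - ξ 2 * ξ 3) * t.1 * (ξ 0 - t.1)).card := by
  set D := ξ 0 * ξ 1 - ξ 2 * ξ 3 with hD
  refine Finset.card_bij' 
    (fun η _ => (η 0, ξ 0 * η 2 - ξ 2 * η 0, ξ 0 * η 3 - ξ 3 * η 0))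
    (fun t _ => ![t.1, (D - ξ 1 * t.1 + ξ 2 * ((t.2.2 + ξ 3 * t.1) / ξ 0) + 
        ξ 3 * ((t.2.1 + ξ 2 * t.1) / ξ 0)) / ξ 0,
        (t.2.1 + ξ 2 * t.1) / ξ 0, (t.2.2 + ξ 3 * t.1) / ξ 0]) ?_ ?_ ?_ ?_
  · intro η h
    simp only [auxS, mem_filter, mem_univ, true_and] at h ⊢
    obtain ⟨h1, h2⟩ := h
    rw [hD]
    linear_combination (-ξ 0 ^ 2 + ξ 0 * η 0) * h1 - ξ 0 * η 0 * h2
  · rintro ⟨x, u, v⟩ h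
    simp only [auxS, mem_filter, mem_univ, true_and] at h ⊢
    simp
    have h' : u * v = (ξ 0 * ξ 1 - ξ 2 * ξ 3) * x * (ξ 0 - x) := h
    rw [hD]
    constructor
    · field_simp
      linear_combination -h'
    · field_simp
      linear_combination -h'
  · intro η h
    simp only [auxS, mem_filter, mem_univ, true_and] at h
    obtain ⟨h1, h2⟩ := h
    funext i
    fin_cases i <;> simp
    · rw [hD]; field_simp
      linear_combination h2 - h1
    · field_simp
    · field_simp
  · rintro ⟨x, u, v⟩ h
    simp
    constructor <;> field_simp <;> ring

lemma aux_perm {F : Type} [Field F] [Fintype F] [DecidableEq F] (σ : Equiv.Perm (Fin 4))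
    (ξ : Fin 4 → F)
    (h : ∀ η : Fin 4 → F, (η (σ 0) * η (σ 1) = η (σ 2) * η (σ 3)) ↔ η 0 * η 1 = η 2 * η 3) :
    (auxS F ξ).card = (auxS F (ξ ∘ σ)).card := by
  refine Finset.card_equiv (Equiv.arrowCongr σ.symm (Equiv.refl F)) ?_
  intro η
  have h1 := h η
  have h2 := h (ξ - η)
  simp only [Pi.sub_apply] at h2
  simp [auxS, h1, h2]

lemma aux_main {F : Type} [Field F] [Fintype F] [DecidableEq F] (ξ : Fin 4 → F) (h : ξ ≠ 0) :
    (auxS F ξ).card = if ξ 0 * ξ 1 = ξ 2 * ξ 3 then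
        Fintype.card F * ((Fintype.card F - 1) + Fintype.card F) else
      Fintype.card F * (Fintype.card F - 1) + 2 * Fintype.card F := by
  have key : ∀ ξ : Fin 4 → F, ξ 0 ≠ 0 → (auxS F ξ).card = if ξ 0 * ξ 1 = ξ 2 * ξ 3 then
        Fintype.card F * ((Fintype.card F - 1) + Fintype.card F) else
      Fintype.card F * (Fintype.card F - 1) + 2 * Fintype.card F := by
    intro ξ h0
    rw [aux_S ξ h0]
    split_ifs with hh
    · exact aux_T0 _ _ (sub_eq_zero.2 hh)
    · exact aux_T1 _ _ h0 (sub_ne_zero.2 hh)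
  have go : ∀ σ : Equiv.Perm (Fin 4), 
      (∀ η : Fin 4 → F, (η (σ 0) * η (σ 1) = η (σ 2) * η (σ 3)) ↔ η 0 * η 1 = η 2 * η 3) →
      ξ (σ 0) ≠ 0 → (auxS F ξ).card = if ξ 0 * ξ 1 = ξ 2 * ξ 3 then
        Fintype.card F * ((Fintype.card F - 1) + Fintype.card F) else
      Fintype.card F * (Fintype.card F - 1) + 2 * Fintype.card F := by
    intro σ hσ h0
    rw [aux_perm σ ξ hσ, key _ h0]
    simp only [Function.comp, hσ ξ]
  obtain ⟨i, hi⟩ := Function.ne_iff.1 h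
  fin_cases i
  · exact key ξ hi
  · refine go (Equiv.swap 0 1) ?_ ?_
    · intro η
      have e2 : (Equiv.swap (0 : Fin 4) 1) 2 = 2 := by decide
      have e3 : (Equiv.swap (0 : Fin 4) 1) 3 = 3 := by decide
      rw [e2, e3]; simp [mul_comm]
    · simpa using hi
  · have e0 : (Equiv.addRight (2 : Fin 4)) 0 = 2 := by decide
    have e1 : (Equiv.addRight (2 : Fin 4)) 1 = 3 := by decide
    have e2 : (Equiv.addRight (2 : Fin 4)) 2 = 0 := by decide
    have e3 : (Equiv.addRight (2 : Fin 4)) 3 = 1 := by decide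
    refine go (Equiv.addRight 2) ?_ ?_
    · intro η
      rw [e0, e1, e2, e3, eq_comm]
    · rw [e0]; simpa using hi
  · have e0 : (Equiv.subLeft (3 : Fin 4)) 0 = 3 := by decide
    have e1 : (Equiv.subLeft (3 : Fin 4)) 1 = 2 := by decide
    have e2 : (Equiv.subLeft (3 : Fin 4)) 2 = 1 := by decide
    have e3 : (Equiv.subLeft (3 : Fin 4)) 3 = 0 := by decide
    refine go (Equiv.subLeft 3) ?_ ?_
    · intro η
      rw [e0, e1, e2, e3, eq_comm, mul_comm (η 1), mul_comm (η 3)]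
    · rw [e0]; simpa using hi

lemma aux_zero {F : Type} [Field F] [Fintype F] [DecidableEq F] :
    (auxS F 0).card = Fintype.card F * Fintype.card F * (Fintype.card F - 1) + 
      ((Fintype.card F - 1) + Fintype.card F) * Fintype.card F := by
  have : (auxS F 0).card = 
      (univ.filter fun t : F × F × F × F => t.2.2.1 * t.2.2.2 = t.1 * t.2.1).card := by
    refine Finset.card_bij' (fun η _ => (η 0, η 1, η 2, η 3)) 
      (fun t _ => ![t.1, t.2.1, t.2.2.1, t.2.2.2]) ?_ ?_ ?_ ?_
    · intro η h
      simp [auxS] at h ⊢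
      exact h.symm
    · rintro ⟨x, y, z, w⟩ h
      simp [auxS] at h ⊢
      exact h.symm
    · intro η h
      funext i
      fin_cases i <;> simp
    · rintro ⟨x, y, z, w⟩ h
      simp
  rw [this, Finset.card_filter]
  simp_rw [Fintype.sum_prod_type, aux_K, Finset.sum_add_distrib]
  have h2 : (∑ x : F, ∑ y : F, if x * y = 0 then Fintype.card F else 0) =
      (∑ x : F, ∑ y : F, if x * y = 0 then 1 else 0) * Fintype.card F := by
    simp only [Finset.sum_mul, ite_mul, one_mul, zero_mul]
  rw [h2, aux_K]
  simp [Finset.card_univ]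
  ring

lemma aux_sigma {F : Type} [Field F] [Fintype F] [DecidableEq F] (ξ : Fin 4 → F) :
    (sigmaSet F ξ).card = (((auxS F ξ).erase 0).erase ξ).card := by
  refine Finset.card_bij' (fun pr _ => pr.1) (fun η _ => (η, ξ - η)) ?_ ?_ ?_ ?_
  · rintro ⟨η, ρ⟩ h
    simp only [sigmaSet, coneM, auxS, mem_filter, mem_product, mem_univ, true_and, mem_erase] at h ⊢
    obtain ⟨⟨⟨h1, h2⟩, h3, h4⟩, rfl⟩ := h
    refine ⟨?_, h1, h2, by simpa using h4⟩
    intro h; apply h3; simpa using h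
  · intro η h
    simp only [sigmaSet, coneM, auxS, mem_filter, mem_product, mem_univ, true_and, mem_erase] at h ⊢
    obtain ⟨h1, h2, h3, h4⟩ := h
    exact ⟨⟨⟨h2, h3⟩, sub_ne_zero.2 (Ne.symm h1), by simpa using h4⟩, by simp⟩
  · rintro ⟨η, ρ⟩ h
    simp only [sigmaSet, mem_filter] at h
    simp [← h.2]
  · intro η h
    rfl

/-- Cardinality of the representation sets: `|Σ_0| = (q+1)²(q-1)`,
`|Σ_ξ| = 2q²-q-2` for `ξ ∈ Γ³`, and `|Σ_ξ| = q²+q` for generic `ξ`. -/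
theorem card_sigmaSet (p n : ℕ) (hp : p.Prime) (hodd : Odd p) (hn : 0 < n)
    (F : Type) [Field F] [Fintype F] [DecidableEq F] (hcard : Fintype.card F = p ^ n)
    (ξ : Fin 4 → F) :
    (ξ = 0 → (sigmaSet F ξ).card = (p ^ n + 1) ^ 2 * (p ^ n - 1)) ∧
    (ξ ∈ coneM F → (sigmaSet F ξ).card = 2 * (p ^ n) ^ 2 - p ^ n - 2) ∧
    (ξ ≠ 0 → ξ ∉ coneM F → (sigmaSet F ξ).card = (p ^ n) ^ 2 + p ^ n) := by
  rw [← hcard]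
  have hq : 1 < Fintype.card F := Fintype.one_lt_card
  obtain ⟨m, hm⟩ : ∃ m, Fintype.card F = m + 1 := ⟨Fintype.card F - 1, by omega⟩
  rw [aux_sigma]
  refine ⟨?_, ?_, ?_⟩
  · rintro rfl
    rw [Finset.erase_idem, Finset.card_erase_of_mem (by simp [auxS]), aux_zero, hm]
    simp only [Nat.add_sub_cancel]
    apply Nat.sub_eq_of_eq_add
    ring
  · intro h
    simp only [coneM, mem_filter, mem_univ, true_and] at h
    rw [Finset.card_erase_of_mem (by simp [auxS, h.1, h.2]), 
      Finset.card_erase_of_mem (by simp [auxS, h.2]), aux_main ξ h.1, if_pos h.2, hm]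
    simp only [Nat.add_sub_cancel]
    have : 2 * (m + 1) ^ 2 = (m + 1) * (m + (m + 1)) + (m + 1) := by ring
    omega
  · intro h0 h
    simp only [coneM, mem_filter, mem_univ, true_and, not_and] at h
    have h := h h0
    rw [Finset.erase_eq_of_notMem (by simp [auxS, h]), 
      Finset.erase_eq_of_notMem (by simp [auxS, h]), aux_main ξ h0, if_neg h, hm]
    simp only [Nat.add_sub_cancel]
    ring
end
end

section
/- Structure of H_ξ for points of the cone: let ξ = π(λ,α,β) and η = π(μ,γ,δ) be points of Γ³, with λ,μ ∈ F_q^× and α,β,γ,δ ∈ P¹. Then η ∈ H_ξ if and only if α = γ or β = δ. Consequently, for every ξ ∈ Γ³, |H_ξ| = (q−1)(2q+1). -/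
open Finset

noncomputable section

/-- The set `H_ξ = {η ∈ Γ³ : (ξ₁-η₁)(ξ₂-η₂) = (ξ₃-η₃)(ξ₄-η₄)}`. -/
def Hset (F : Type) [Field F] [Fintype F] [DecidableEq F] (ξ : Fin 4 → F) :
    Finset (Fin 4 → F) :=
  (coneM F).filter fun η => (ξ 0 - η 0) * (ξ 1 - η 1) = (ξ 2 - η 2) * (ξ 3 - η 3)

/-- Representatives of the projective line `P¹(F_q)`: `{(1,y) : y ∈ F_q} ∪ {(0,1)}`. -/
def P1fin (F : Type) [Field F] [Fintype F] [DecidableEq F] : Finset (F × F) :=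
  (univ.image fun y => ((1 : F), y)) ∪ {((0 : F), (1 : F))}

/-- The Segre-type parametrization
`π(λ,(α₁,α₂),(β₁,β₂)) = (λα₁β₁, λα₂β₂, λα₁β₂, λα₂β₁)`. -/
def segre (F : Type) [Field F] (t : F × (F × F) × (F × F)) : Fin 4 → F :=
  ![t.1 * t.2.1.1 * t.2.2.1, t.1 * t.2.1.2 * t.2.2.2,
    t.1 * t.2.1.1 * t.2.2.2, t.1 * t.2.1.2 * t.2.2.1]

theorem mem_P1 {F : Type} [Field F] [Fintype F] [DecidableEq F] {a : F × F} :
    a ∈ P1fin F ↔ (∃ y, a = (1, y)) ∨ a = (0, 1) := by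
  unfold P1fin
  simp only [mem_union, mem_image, mem_univ, true_and, mem_singleton]
  constructor
  · rintro (⟨y, rfl⟩ | h)
    · exact Or.inl ⟨y, rfl⟩
    · exact Or.inr h
  · rintro (⟨y, rfl⟩ | h)
    · exact Or.inl ⟨y, rfl⟩
    · exact Or.inr h

theorem card_P1 {F : Type} [Field F] [Fintype F] [DecidableEq F] :
    (P1fin F).card = Fintype.card F + 1 := by
  unfold P1fin
  rw [card_union_of_disjoint, card_image_of_injective, card_univ, card_singleton]
  · intro x y h
    simpa using h
  · simp

theorem P1_cross {F : Type} [Field F] [Fintype F] [DecidableEq F] {a c : F × F}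
    (ha : a ∈ P1fin F) (hc : c ∈ P1fin F) : a.1 * c.2 - a.2 * c.1 = 0 ↔ a = c := by
  rcases mem_P1.1 ha with ⟨y, rfl⟩ | rfl <;> rcases mem_P1.1 hc with ⟨z, rfl⟩ | rfl <;>
    simp [sub_eq_zero, eq_comm]

theorem segre_mem_cone {F : Type} [Field F] [Fintype F] [DecidableEq F] {l : F} (hl : l ≠ 0)
    {a b : F × F} (ha : a ∈ P1fin F) (hb : b ∈ P1fin F) : segre F (l, a, b) ∈ coneM F := by
  unfold coneM
  simp only [mem_filter, mem_univ, true_and]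
  constructor
  · intro h
    have h0 := congrFun h 0
    have h1 := congrFun h 1
    have h2 := congrFun h 2
    have h3 := congrFun h 3
    rcases mem_P1.1 ha with ⟨y, rfl⟩ | rfl <;> rcases mem_P1.1 hb with ⟨z, rfl⟩ | rfl <;>
      simp_all [segre]
  · simp [segre]; ring

theorem segre_inj {F : Type} [Field F] [Fintype F] [DecidableEq F] {l m : F} (hl : l ≠ 0)
    (hm : m ≠ 0) {a b c d : F × F} (ha : a ∈ P1fin F) (hb : b ∈ P1fin F)
    (hc : c ∈ P1fin F) (hd : d ∈ P1fin F) (h : segre F (l, a, b) = segre F (m, c, d)) :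
    l = m ∧ a = c ∧ b = d := by
  have h0 := congrFun h 0
  have h1 := congrFun h 1
  have h2 := congrFun h 2
  have h3 := congrFun h 3
  clear h
  rcases mem_P1.1 ha with ⟨y, rfl⟩ | rfl <;> rcases mem_P1.1 hb with ⟨z, rfl⟩ | rfl <;>
    rcases mem_P1.1 hc with ⟨u, rfl⟩ | rfl <;> rcases mem_P1.1 hd with ⟨v, rfl⟩ | rfl <;>
      clear ha hb hc hd <;> simp [segre] at h0 h1 h2 h3 <;> simp_all

theorem segre_surj {F : Type} [Field F] [Fintype F] [DecidableEq F] {x : Fin 4 → F}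
    (hx : x ∈ coneM F) : ∃ l a b, l ≠ 0 ∧ a ∈ P1fin F ∧ b ∈ P1fin F ∧ segre F (l, a, b) = x := by
  unfold coneM at hx
  simp only [mem_filter, mem_univ, true_and] at hx
  obtain ⟨hne, he⟩ := hx
  have hp : ∀ y : F, ((1 : F), y) ∈ P1fin F := fun y => mem_P1.2 (Or.inl ⟨y, rfl⟩)
  have hq : ((0 : F), (1 : F)) ∈ P1fin F := mem_P1.2 (Or.inr rfl)
  by_cases h0 : x 0 = 0
  · by_cases h2 : x 2 = 0
    · by_cases h3 : x 3 = 0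
      · have h1 : x 1 ≠ 0 := by
          intro h1
          apply hne
          ext i
          fin_cases i <;> simp [h0, h1, h2, h3]
        refine ⟨x 1, (0, 1), (0, 1), h1, hq, hq, ?_⟩
        ext i
        fin_cases i <;> simp [segre, h0, h2, h3]
      · refine ⟨x 3, (0, 1), (1, x 1 / x 3), h3, hq, hp _, ?_⟩
        ext i
        fin_cases i <;> simp [segre, h0, h2] <;> field_simp
    · have h3 : x 3 = 0 := by simpa [h0, h2] using he
      refine ⟨x 2, (1, x 1 / x 2), (0, 1), h2, hp _, hq, ?_⟩
      ext i
      fin_cases i <;> simp [segre, h0, h3] <;> field_simp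
  · refine ⟨x 0, (1, x 3 / x 0), (1, x 2 / x 0), h0, hp _, hp _, ?_⟩
    ext i
    fin_cases i <;> simp [segre] <;> field_simp
    linear_combination -he

theorem segre_mem_H {F : Type} [Field F] [Fintype F] [DecidableEq F] {l m : F} (hl : l ≠ 0)
    (hm : m ≠ 0) {a b c d : F × F} (ha : a ∈ P1fin F) (hb : b ∈ P1fin F)
    (hc : c ∈ P1fin F) (hd : d ∈ P1fin F) :
    segre F (m, c, d) ∈ Hset F (segre F (l, a, b)) ↔ a = c ∨ b = d := by
  unfold Hset
  rw [mem_filter, ← P1_cross ha hc, ← P1_cross hb hd, ← mul_eq_zero]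
  simp only [segre_mem_cone hm hc hd, true_and]
  have key : (l * m) * ((a.1 * c.2 - a.2 * c.1) * (b.1 * d.2 - b.2 * d.1)) = 0 ↔
      (a.1 * c.2 - a.2 * c.1) * (b.1 * d.2 - b.2 * d.1) = 0 := by
    simp [hl, hm]
  rw [← key]
  simp only [segre, Matrix.cons_val]
  constructor <;> intro h <;> linear_combination -h

theorem card_H {F : Type} [Field F] [Fintype F] [DecidableEq F] {x : Fin 4 → F}
    (hx : x ∈ coneM F) :
    (Hset F x).card = (Fintype.card F - 1) * (2 * Fintype.card F + 1) := by
  obtain ⟨l, a, b, hl, ha, hb, rfl⟩ := segre_surj hx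
  have h1 : Hset F (segre F (l, a, b)) =
      ((univ.erase (0 : F)) ×ˢ (({a} ×ˢ P1fin F) ∪ (P1fin F ×ˢ {b}))).image (segre F) := by
    ext y
    simp only [mem_image, mem_product, mem_erase, mem_univ, and_true, mem_union, mem_singleton,
      Prod.exists]
    constructor
    · intro hy
      have hy' : y ∈ coneM F := by
        unfold Hset at hy
        exact (mem_filter.1 hy).1
      obtain ⟨m, c, d, hm, hc, hd, rfl⟩ := segre_surj hy'
      rw [segre_mem_H hl hm ha hb hc hd] at hy
      refine ⟨m, c.1, c.2, d.1, d.2, ⟨hm, ?_⟩, rfl⟩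
      rcases hy with rfl | rfl
      · exact Or.inl ⟨rfl, hd⟩
      · exact Or.inr ⟨hc, rfl⟩
    · rintro ⟨m, c1, c2, d1, d2, ⟨hm, h⟩, rfl⟩
      rcases h with ⟨h, h'⟩ | ⟨h', h⟩
      · exact (segre_mem_H hl hm ha hb (h ▸ ha) h').2 (Or.inl h.symm)
      · exact (segre_mem_H hl hm ha hb h' (h ▸ hb)).2 (Or.inr h.symm)
  have h2 : (({a} ×ˢ P1fin F) ∪ (P1fin F ×ˢ {b})).card = 2 * Fintype.card F + 1 := by
    have h3 := card_union_add_card_inter ({a} ×ˢ P1fin F) (P1fin F ×ˢ {b})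
    have h4 : ({a} ×ˢ P1fin F) ∩ (P1fin F ×ˢ {b}) = {(a, b)} := by
      ext ⟨c, d⟩
      simp only [mem_inter, mem_product, mem_singleton, Prod.mk.injEq]
      constructor
      · rintro ⟨⟨h, _⟩, _, h'⟩
        exact ⟨h, h'⟩
      · rintro ⟨rfl, rfl⟩
        exact ⟨⟨rfl, hb⟩, ha, rfl⟩
    rw [h4, card_product, card_product, card_P1, card_singleton, card_singleton,
      card_singleton] at h3
    omega
  have hsub : ∀ t ∈ ({a} ×ˢ P1fin F) ∪ (P1fin F ×ˢ {b}), t.1 ∈ P1fin F ∧ t.2 ∈ P1fin F := by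
    intro t ht
    simp only [mem_union, mem_product, mem_singleton] at ht
    rcases ht with ⟨h, h'⟩ | ⟨h', h⟩
    · exact ⟨h ▸ ha, h'⟩
    · exact ⟨h', h ▸ hb⟩
  rw [h1, card_image_of_injOn, card_product, h2, card_erase_of_mem (mem_univ _), card_univ]
  rintro ⟨m, c, d⟩ ht ⟨m', c', d'⟩ ht' h
  rw [mem_coe, mem_product] at ht ht'
  obtain ⟨hc, hd⟩ := hsub _ ht.2
  obtain ⟨hc', hd'⟩ := hsub _ ht'.2
  obtain ⟨e1, e2, e3⟩ := segre_inj (ne_of_mem_erase ht.1) (ne_of_mem_erase ht'.1) hc hd hc' hd' h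
  simp only at e1 e2 e3
  rw [e1, e2, e3]

/-- For `ξ = π(λ,α,β)` and `η = π(μ,γ,δ)` in `Γ³`, one has `η ∈ H_ξ` iff `α = γ` or
`β = δ`; consequently `|H_ξ| = (q-1)(2q+1)` for every `ξ ∈ Γ³`. -/
theorem Hset_structure (p n : ℕ) (hp : p.Prime) (hodd : Odd p) (hn : 0 < n)
    (F : Type) [Field F] [Fintype F] [DecidableEq F] (hcard : Fintype.card F = p ^ n) :
    (∀ lam mu : F, lam ≠ 0 → mu ≠ 0 → ∀ α β γ δ : F × F,
      α ∈ P1fin F → β ∈ P1fin F → γ ∈ P1fin F → δ ∈ P1fin F →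
      (segre F (mu, γ, δ) ∈ Hset F (segre F (lam, α, β)) ↔ α = γ ∨ β = δ)) ∧
    (∀ ξ ∈ coneM F, (Hset F ξ).card = (p ^ n - 1) * (2 * p ^ n + 1)) := by
  refine ⟨fun lam mu hl hm α β γ δ ha hb hc hd => segre_mem_H hl hm ha hb hc hd, ?_⟩
  intro ξ hξ
  rw [card_H hξ, hcard]
end
end

section
/- Transversal punctured planes meet in a punctured line: for any ξ = π(λ,α,β) ∈ Γ³ and η = π(μ,γ,δ) ∈ Γ³, the intersection A_ξ^+ ∩ A_η^− equals {π(σ,α,δ) : σ ∈ F_q^×}; in particular A_ξ^+ ∩ A_η^− is nonempty and has exactly q−1 elements. -/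
open Finset

noncomputable section

/-- The nonzero elements of `F`. -/
def Fx (F : Type) [Field F] [Fintype F] [DecidableEq F] : Finset F :=
  univ.filter fun x => x ≠ 0

/-- `H_ξ⁺ = {π(μ,α,y) : μ ∈ F_q^×, y ∈ P¹, y ≠ β}` for `ξ = π(λ,α,β)`. -/
def HplusFin (F : Type) [Field F] [Fintype F] [DecidableEq F] (α β : F × F) :
    Finset (Fin 4 → F) :=
  ((Fx F) ×ˢ ((P1fin F).erase β)).image fun t => segre F (t.1, α, t.2)

/-- `H_ξ⁻ = {π(μ,x,β) : μ ∈ F_q^×, x ∈ P¹, x ≠ α}` for `ξ = π(λ,α,β)`. -/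
def HminusFin (F : Type) [Field F] [Fintype F] [DecidableEq F] (α β : F × F) :
    Finset (Fin 4 → F) :=
  ((Fx F) ×ˢ ((P1fin F).erase α)).image fun t => segre F (t.1, t.2, β)

/-- The punctured line `L_ξ = {μξ : μ ∈ F_q^×}`. -/
def lineFin (F : Type) [Field F] [Fintype F] [DecidableEq F] (ξ : Fin 4 → F) :
    Finset (Fin 4 → F) :=
  (Fx F).image fun μ => μ • ξ

/-- The punctured plane `A_ξ⁺ = H_ξ⁺ ∪ L_ξ` for `ξ = π(λ,α,β)`. -/
def AplusFin (F : Type) [Field F] [Fintype F] [DecidableEq F] (lam : F) (α β : F × F) :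
    Finset (Fin 4 → F) :=
  HplusFin F α β ∪ lineFin F (segre F (lam, α, β))

/-- The punctured plane `A_ξ⁻ = H_ξ⁻ ∪ L_ξ` for `ξ = π(λ,α,β)`. -/
def AminusFin (F : Type) [Field F] [Fintype F] [DecidableEq F] (lam : F) (α β : F × F) :
    Finset (Fin 4 → F) :=
  HminusFin F α β ∪ lineFin F (segre F (lam, α, β))

theorem mem_Fx_aux (F : Type) [Field F] [Fintype F] [DecidableEq F] (x : F) :
    x ∈ Fx F ↔ x ≠ 0 := by simp [Fx]

theorem mem_P1_aux (F : Type) [Field F] [Fintype F] [DecidableEq F] (x : F × F) :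
    x ∈ P1fin F ↔ (∃ y, x = (1, y)) ∨ x = (0, 1) := by
  simp [P1fin, eq_comm, or_comm]

theorem segre_inj_aux (F : Type) [Field F] [Fintype F] [DecidableEq F] (a b : F)
    (ha : a ≠ 0) (hb : b ≠ 0) (α β γ δ : F × F)
    (hα : α ∈ P1fin F) (hβ : β ∈ P1fin F) (hγ : γ ∈ P1fin F) (hδ : δ ∈ P1fin F)
    (h : segre F (a, α, β) = segre F (b, γ, δ)) : a = b ∧ α = γ ∧ β = δ := by
  have h0 := congrFun h 0
  have h1 := congrFun h 1
  have h2 := congrFun h 2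
  have h3 := congrFun h 3
  simp only [segre] at h0 h1 h2 h3
  rw [mem_P1_aux] at hα hβ hγ hδ
  rcases hα with ⟨x, rfl⟩ | rfl <;> rcases hβ with ⟨y, rfl⟩ | rfl <;>
  rcases hγ with ⟨z, rfl⟩ | rfl <;> rcases hδ with ⟨w, rfl⟩ | rfl <;>
  simp at h0 h1 h2 h3 ⊢ <;> grind

theorem smul_segre_aux (F : Type) [Field F] (c a : F) (α β : F × F) :
    c • segre F (a, α, β) = segre F (c * a, α, β) := by
  ext i
  fin_cases i <;> simp [segre, mul_assoc]

theorem mem_line_aux (F : Type) [Field F] [Fintype F] [DecidableEq F] (lam : F)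
    (hlam : lam ≠ 0) (α β : F × F) (v : Fin 4 → F) :
    v ∈ lineFin F (segre F (lam, α, β)) ↔ ∃ s, s ≠ 0 ∧ segre F (s, α, β) = v := by
  simp only [lineFin, mem_image, mem_Fx_aux, smul_segre_aux]
  constructor
  · rintro ⟨c, hc, rfl⟩
    exact ⟨c * lam, mul_ne_zero hc hlam, rfl⟩
  · rintro ⟨s, hs, rfl⟩
    exact ⟨s / lam, div_ne_zero hs hlam, by rw [div_mul_cancel₀ _ hlam]⟩

theorem mem_Aplus_aux (F : Type) [Field F] [Fintype F] [DecidableEq F] (lam : F)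
    (hlam : lam ≠ 0) (α β : F × F) (hβ : β ∈ P1fin F) (v : Fin 4 → F) :
    v ∈ AplusFin F lam α β ↔
      ∃ s, s ≠ 0 ∧ ∃ y ∈ P1fin F, segre F (s, α, y) = v := by
  rw [AplusFin, mem_union, mem_line_aux F lam hlam]
  simp only [HplusFin, mem_image, mem_product, mem_Fx_aux, mem_erase, Prod.exists]
  constructor
  · rintro (⟨s, y1, y2, ⟨hs, _, hy⟩, h⟩ | ⟨s, hs, h⟩)
    · exact ⟨s, hs, y1, y2, hy, h⟩
    · exact ⟨s, hs, β.1, β.2, hβ, h⟩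
  · rintro ⟨s, hs, y1, y2, hy, h⟩
    by_cases e : (y1, y2) = β
    · right; subst e; exact ⟨s, hs, h⟩
    · left; exact ⟨s, y1, y2, ⟨hs, e, hy⟩, h⟩

theorem mem_Aminus_aux (F : Type) [Field F] [Fintype F] [DecidableEq F] (lam : F)
    (hlam : lam ≠ 0) (α β : F × F) (hα : α ∈ P1fin F) (v : Fin 4 → F) :
    v ∈ AminusFin F lam α β ↔
      ∃ s, s ≠ 0 ∧ ∃ y ∈ P1fin F, segre F (s, y, β) = v := by
  rw [AminusFin, mem_union, mem_line_aux F lam hlam]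
  simp only [HminusFin, mem_image, mem_product, mem_Fx_aux, mem_erase, Prod.exists]
  constructor
  · rintro (⟨s, y1, y2, ⟨hs, _, hy⟩, h⟩ | ⟨s, hs, h⟩)
    · exact ⟨s, hs, y1, y2, hy, h⟩
    · exact ⟨s, hs, α.1, α.2, hα, h⟩
  · rintro ⟨s, hs, y1, y2, hy, h⟩
    by_cases e : (y1, y2) = α
    · right; subst e; exact ⟨s, hs, h⟩
    · left; exact ⟨s, y1, y2, ⟨hs, e, hy⟩, h⟩

/-- Transversal punctured planes meet in a punctured line: for `ξ = π(λ,α,β)` and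
`η = π(μ,γ,δ)` in `Γ³`, the intersection `A_ξ⁺ ∩ A_η⁻` equals
`{π(σ,α,δ) : σ ∈ F_q^×}`; in particular it is nonempty with exactly `q-1` elements. -/
theorem Aplus_inter_Aminus (p n : ℕ) (hp : p.Prime) (hodd : Odd p) (hn : 0 < n)
    (F : Type) [Field F] [Fintype F] [DecidableEq F] (hcard : Fintype.card F = p ^ n)
    (lam mu : F) (hlam : lam ≠ 0) (hmu : mu ≠ 0) (α β γ δ : F × F)
    (hα : α ∈ P1fin F) (hβ : β ∈ P1fin F) (hγ : γ ∈ P1fin F) (hδ : δ ∈ P1fin F) :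
    AplusFin F lam α β ∩ AminusFin F mu γ δ =
      (Fx F).image (fun σ => segre F (σ, α, δ)) ∧
    (AplusFin F lam α β ∩ AminusFin F mu γ δ).Nonempty ∧
    (AplusFin F lam α β ∩ AminusFin F mu γ δ).card = p ^ n - 1 := by
  have key : AplusFin F lam α β ∩ AminusFin F mu γ δ =
      (Fx F).image (fun σ => segre F (σ, α, δ)) := by
    ext v
    rw [mem_inter, mem_Aplus_aux F lam hlam α β hβ, mem_Aminus_aux F mu hmu γ δ hγ]
    simp only [mem_image, mem_Fx_aux]
    constructor
    · rintro ⟨⟨s, hs, y, hy, h⟩, ⟨t, ht, x, hx, h'⟩⟩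
      obtain ⟨_, _, e⟩ := segre_inj_aux F s t hs ht α y x δ hα hy hx hδ (h.trans h'.symm)
      exact ⟨s, hs, by rw [← e, h]⟩
    · rintro ⟨s, hs, h⟩
      exact ⟨⟨s, hs, δ, hδ, h⟩, ⟨s, hs, α, hα, h⟩⟩
  refine ⟨key, ?_, ?_⟩
  · rw [key]
    exact ⟨_, mem_image_of_mem _ ((mem_Fx_aux F 1).2 one_ne_zero)⟩
  · rw [key, card_image_of_injOn, ← hcard]
    · have : Fx F = univ.erase 0 := by ext; simp [Fx]
      rw [this, card_erase_of_mem (mem_univ _), card_univ]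
    · intro s hs t ht h
      exact (segre_inj_aux F s t ((mem_Fx_aux F s).1 hs) ((mem_Fx_aux F t).1 ht)
        α δ α δ hα hδ hα hδ h).1
end
end

section
/- Mixed product identity over the cone: for every function f : Γ³ → ℝ, ∑_{ξ∈Γ³} ( ∑_{η∈A_ξ^+} f(η)² ) · ( ∑_{ρ∈A_ξ^−} f(ρ)² ) = (q−1) · ( ∑_{η∈Γ³} f(η)² )². -/
open Finset

noncomputable section

theorem mem_P1fin' {F : Type} [Field F] [Fintype F] [DecidableEq F] {a : F × F}
    (h : a ∈ P1fin F) : (∃ y, a = (1, y)) ∨ a = (0, 1) := by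
  simp only [P1fin, mem_union, mem_image, mem_univ, true_and, mem_singleton] at h
  rcases h with ⟨y, hy⟩ | h
  · exact Or.inl ⟨y, hy.symm⟩
  · exact Or.inr h

theorem one_mem_P1fin {F : Type} [Field F] [Fintype F] [DecidableEq F] (y : F) :
    ((1 : F), y) ∈ P1fin F := by simp [P1fin]

theorem inf_mem_P1fin {F : Type} [Field F] [Fintype F] [DecidableEq F] :
    ((0 : F), (1 : F)) ∈ P1fin F := by simp [P1fin]

theorem segre_injOn (F : Type) [Field F] [Fintype F] [DecidableEq F] :
    Set.InjOn (segre F) ((Fx F ×ˢ (P1fin F ×ˢ P1fin F) : Finset _) : Set (F × (F × F) × (F × F))) := by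
  rintro ⟨l, a, b⟩ h ⟨l', a', b'⟩ h' he
  simp only [coe_product, Set.mem_prod, mem_coe] at h h'
  obtain ⟨hl, ha, hb⟩ := h
  obtain ⟨hl', ha', hb'⟩ := h'
  simp only [Fx, mem_filter, mem_univ, true_and] at hl hl'
  have e0 := congrFun he 0
  have e1 := congrFun he 1
  have e2 := congrFun he 2
  have e3 := congrFun he 3
  simp [segre] at e0 e1 e2 e3
  rcases mem_P1fin' ha with ⟨y, rfl⟩ | rfl <;> rcases mem_P1fin' hb with ⟨z, rfl⟩ | rfl <;>
  rcases mem_P1fin' ha' with ⟨y', rfl⟩ | rfl <;> rcases mem_P1fin' hb' with ⟨z', rfl⟩ | rfl <;>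
  simp_all

theorem segre_image (F : Type) [Field F] [Fintype F] [DecidableEq F] :
    (Fx F ×ˢ (P1fin F ×ˢ P1fin F)).image (segre F) = coneM F := by
  ext η
  simp only [mem_image, mem_product, coneM, mem_filter, mem_univ, true_and]
  constructor
  · rintro ⟨⟨l, a, b⟩, ⟨hl, ha, hb⟩, rfl⟩
    simp only [Fx, mem_filter, mem_univ, true_and] at hl
    constructor
    · intro he
      have e0 := congrFun he 0
      have e1 := congrFun he 1
      have e2 := congrFun he 2
      have e3 := congrFun he 3
      simp [segre] at e0 e1 e2 e3
      rcases mem_P1fin' ha with ⟨y, rfl⟩ | rfl <;> rcases mem_P1fin' hb with ⟨z, rfl⟩ | rfl <;>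
        simp_all
    · simp [segre]; ring
  · rintro ⟨h0, hc⟩
    have mk : ∀ l a b, l ≠ 0 → a ∈ P1fin F → b ∈ P1fin F → segre F (l, a, b) = η →
        ∃ t : F × (F × F) × (F × F), (t.1 ∈ Fx F ∧ t.2.1 ∈ P1fin F ∧ t.2.2 ∈ P1fin F) ∧
          segre F t = η := fun l a b hl ha hb h =>
      ⟨(l, a, b), ⟨by simpa [Fx] using hl, ha, hb⟩, h⟩
    by_cases c0 : η 0 = 0
    · by_cases c2 : η 2 = 0
      · by_cases c3 : η 3 = 0
        · have c1 : η 1 ≠ 0 := by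
            intro c1; apply h0; ext i; fin_cases i <;> simp [*]
          refine mk (η 1) (0, 1) (0, 1) c1 inf_mem_P1fin inf_mem_P1fin ?_
          ext i; fin_cases i <;> simp [segre, *]
        · refine mk (η 3) (0, 1) (1, η 1 / η 3) c3 inf_mem_P1fin (one_mem_P1fin _) ?_
          ext i; fin_cases i <;> simp [segre, *]
          field_simp
      · have c3 : η 3 = 0 := by
          rw [c0, zero_mul] at hc
          simpa [c2] using hc.symm
        refine mk (η 2) (1, η 1 / η 2) (0, 1) c2 (one_mem_P1fin _) inf_mem_P1fin ?_
        ext i; fin_cases i <;> simp [segre, *]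
        field_simp
    · refine mk (η 0) (1, η 3 / η 0) (1, η 2 / η 0) c0 (one_mem_P1fin _) (one_mem_P1fin _) ?_
      ext i; fin_cases i <;> simp [segre] <;> field_simp
      rw [hc]; ring

theorem line_eq (F : Type) [Field F] [Fintype F] [DecidableEq F] (l : F) (hl : l ∈ Fx F)
    (a b : F × F) : lineFin F (segre F (l, a, b)) = (Fx F).image fun m => segre F (m, a, b) := by
  simp only [Fx, mem_filter, mem_univ, true_and] at hl
  have hs : ∀ m, m • segre F (l, a, b) = segre F (m * l, a, b) := by
    intro m; ext i; fin_cases i <;> simp [segre] <;> ring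
  ext η
  simp only [lineFin, mem_image, Fx, mem_filter, mem_univ, true_and, hs]
  constructor
  · rintro ⟨m, hm, rfl⟩
    exact ⟨m * l, mul_ne_zero hm hl, rfl⟩
  · rintro ⟨m, hm, rfl⟩
    exact ⟨m / l, div_ne_zero hm hl, by rw [div_mul_cancel₀ _ hl]⟩

theorem Aplus_eq (F : Type) [Field F] [Fintype F] [DecidableEq F] (l : F) (hl : l ∈ Fx F)
    (a b : F × F) (hb : b ∈ P1fin F) :
    AplusFin F l a b = (Fx F ×ˢ P1fin F).image fun t => segre F (t.1, a, t.2) := by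
  rw [AplusFin, line_eq F l hl, HplusFin]
  ext η
  simp only [mem_union, mem_image, mem_product, mem_erase]
  constructor
  · rintro (⟨⟨m, y⟩, ⟨hm, -, hy⟩, h⟩ | ⟨m, hm, h⟩)
    · exact ⟨(m, y), ⟨hm, hy⟩, h⟩
    · exact ⟨(m, b), ⟨hm, hb⟩, h⟩
  · rintro ⟨⟨m, y⟩, ⟨hm, hy⟩, h⟩
    by_cases hyb : y = b
    · subst hyb; exact Or.inr ⟨m, hm, h⟩
    · exact Or.inl ⟨(m, y), ⟨hm, hyb, hy⟩, h⟩

theorem Aminus_eq (F : Type) [Field F] [Fintype F] [DecidableEq F] (l : F) (hl : l ∈ Fx F)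
    (a b : F × F) (ha : a ∈ P1fin F) :
    AminusFin F l a b = (Fx F ×ˢ P1fin F).image fun t => segre F (t.1, t.2, b) := by
  rw [AminusFin, line_eq F l hl, HminusFin]
  ext η
  simp only [mem_union, mem_image, mem_product, mem_erase]
  constructor
  · rintro (⟨⟨m, y⟩, ⟨hm, -, hy⟩, h⟩ | ⟨m, hm, h⟩)
    · exact ⟨(m, y), ⟨hm, hy⟩, h⟩
    · exact ⟨(m, a), ⟨hm, ha⟩, h⟩
  · rintro ⟨⟨m, y⟩, ⟨hm, hy⟩, h⟩
    by_cases hyb : y = a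
    · subst hyb; exact Or.inr ⟨m, hm, h⟩
    · exact Or.inl ⟨(m, y), ⟨hm, hyb, hy⟩, h⟩

theorem sum_Aplus (F : Type) [Field F] [Fintype F] [DecidableEq F] (l : F) (hl : l ∈ Fx F)
    (a b : F × F) (ha : a ∈ P1fin F) (hb : b ∈ P1fin F) (g : (Fin 4 → F) → ℝ) :
    ∑ η ∈ AplusFin F l a b, g η = ∑ m ∈ Fx F, ∑ y ∈ P1fin F, g (segre F (m, a, y)) := by
  rw [Aplus_eq F l hl a b hb, sum_image, sum_product]
  rintro ⟨m, y⟩ h ⟨m', y'⟩ h' he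
  simp only [coe_product, Set.mem_prod, mem_coe] at h h'
  have := segre_injOn F (x₁ := (m, a, y)) (x₂ := (m', a, y')) (by simp [h, ha]) (by simp [h', ha]) he
  simpa using this

theorem sum_Aminus (F : Type) [Field F] [Fintype F] [DecidableEq F] (l : F) (hl : l ∈ Fx F)
    (a b : F × F) (ha : a ∈ P1fin F) (hb : b ∈ P1fin F) (g : (Fin 4 → F) → ℝ) :
    ∑ η ∈ AminusFin F l a b, g η = ∑ m ∈ Fx F, ∑ y ∈ P1fin F, g (segre F (m, y, b)) := by
  rw [Aminus_eq F l hl a b ha, sum_image, sum_product]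
  rintro ⟨m, y⟩ h ⟨m', y'⟩ h' he
  simp only [coe_product, Set.mem_prod, mem_coe] at h h'
  have := segre_injOn F (x₁ := (m, y, b)) (x₂ := (m', y', b)) (by simp [h, hb]) (by simp [h', hb]) he
  simpa using this

theorem sum_cone (F : Type) [Field F] [Fintype F] [DecidableEq F] (g : (Fin 4 → F) → ℝ) :
    ∑ η ∈ coneM F, g η =
      ∑ m ∈ Fx F, ∑ x ∈ P1fin F, ∑ y ∈ P1fin F, g (segre F (m, x, y)) := by
  rw [← segre_image, sum_image (segre_injOn F), sum_product]
  simp only [sum_product]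

theorem card_Fx (F : Type) [Field F] [Fintype F] [DecidableEq F] :
    ((Fx F).card : ℝ) = (Fintype.card F : ℝ) - 1 := by
  have : Fx F = univ.erase 0 := by ext; simp [Fx]
  rw [this, card_erase_of_mem (mem_univ _), card_univ, Nat.cast_sub Fintype.card_pos]
  simp

/-- Mixed product identity over the cone: summing over `ξ ∈ Γ³` (written in Segre
coordinates `ξ = π(λ,α,β)`, which parametrize `Γ³` bijectively) the product of the
squared masses of `f` on the two punctured planes `A_ξ⁺`, `A_ξ⁻` gives
`(q-1)(∑_{Γ³} f²)²`. -/
theorem mixed_product_identity (p n : ℕ) (hp : p.Prime) (hodd : Odd p) (hn : 0 < n)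
    (F : Type) [Field F] [Fintype F] [DecidableEq F] (hcard : Fintype.card F = p ^ n)
    (f : (Fin 4 → F) → ℝ) :
    ∑ lam ∈ Fx F, ∑ α ∈ P1fin F, ∑ β ∈ P1fin F,
      (∑ η ∈ AplusFin F lam α β, f η ^ 2) * (∑ ρ ∈ AminusFin F lam α β, f ρ ^ 2) =
    ((p : ℝ) ^ n - 1) * (∑ η ∈ coneM F, f η ^ 2) ^ 2 := by
  have hq : ((p : ℝ) ^ n - 1) = ((Fx F).card : ℝ) := by
    rw [card_Fx, hcard]; push_cast; rfl
  have key : ∀ l ∈ Fx F, ∑ α ∈ P1fin F, ∑ β ∈ P1fin F,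
      (∑ η ∈ AplusFin F l α β, f η ^ 2) * (∑ ρ ∈ AminusFin F l α β, f ρ ^ 2) =
      (∑ η ∈ coneM F, f η ^ 2) ^ 2 := by
    intro l hl
    have h1 : ∑ η ∈ coneM F, f η ^ 2 =
        ∑ x ∈ P1fin F, ∑ m ∈ Fx F, ∑ y ∈ P1fin F, f (segre F (m, x, y)) ^ 2 := by
      rw [sum_cone, sum_comm]
    have h2 : ∑ η ∈ coneM F, f η ^ 2 =
        ∑ y ∈ P1fin F, ∑ m ∈ Fx F, ∑ x ∈ P1fin F, f (segre F (m, x, y)) ^ 2 := by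
      rw [sum_cone, sum_comm' (s' := fun _ => Fx F) (t' := P1fin F) (by tauto)]
      rw [sum_comm]
      rw [sum_comm (s := P1fin F) (t := Fx F)]
      exact sum_congr rfl fun m _ => sum_comm
    rw [sq]
    nth_rewrite 1 [h1]
    rw [h2, sum_mul_sum]
    refine sum_congr rfl fun a ha => sum_congr rfl fun b hb => ?_
    rw [sum_Aplus F l hl a b ha hb (fun η => f η ^ 2),
      sum_Aminus F l hl a b ha hb (fun η => f η ^ 2)]
  rw [sum_congr rfl key, sum_const, nsmul_eq_mul, hq]
end
end

section
/- Solutions of the multiplicative functional equation on the punctured plane: let ψ : F_q² \ {0} → ℂ \ {0} satisfy ψ(x)·ψ(y) = ψ(z)·ψ(w) for all nonzero x, y, z, w ∈ F_q² with x + y = z + w. Then there exist λ ∈ ℂ \ {0} and (a₁,a₂) ∈ F_q² such that ψ(x₁,x₂) = λ·exp((2πi/p)·Tr_n(a₁x₁+a₂x₂)) for all (x₁,x₂) ∈ F_q² \ {0}; equivalently, ψ is a nonzero scalar multiple of the restriction to F_q² \ {0} of an additive character of (F_q²,+). -/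
open Finset

noncomputable section

/-- The field trace `Tr_n(x) = ∑_{r=0}^{n-1} x^{p^r}` (with values in the prime field of `F`). -/
def traceN (p n : ℕ) (F : Type) [Field F] (x : F) : F :=
  ∑ r ∈ Finset.range n, x ^ p ^ r

theorem aux_char_exists (A : Type) [AddCommGroup A] [Fintype A] [DecidableEq A]
    (hA : 4 ≤ Fintype.card A) (ψ : A → ℂ)
    (hψ0 : ∀ x : A, x ≠ 0 → ψ x ≠ 0)
    (hψ : ∀ x y z w : A, x ≠ 0 → y ≠ 0 → z ≠ 0 → w ≠ 0 → x + y = z + w →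
      ψ x * ψ y = ψ z * ψ w) :
    ∃ lam : ℂ, lam ≠ 0 ∧ ∃ χ : AddChar A ℂ, ∀ x : A, x ≠ 0 → ψ x = lam * χ x := by
  have avoid : ∀ a b c : A, ∃ x, x ≠ a ∧ x ≠ b ∧ x ≠ c := by
    intro a b c
    have h : (({a, b, c} : Finset A)).card < (Finset.univ : Finset A).card := by
      have := Finset.card_le_three (a := a) (b := b) (c := c)
      rw [Finset.card_univ]; omega
    obtain ⟨x, -, hx⟩ := Finset.exists_mem_notMem_of_card_lt_card h
    simp only [Finset.mem_insert, Finset.mem_singleton, not_or] at hx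
    exact ⟨x, hx⟩
  have h1 : ∀ d : A, ∃ x, x ≠ 0 ∧ x + d ≠ 0 := by
    intro d
    obtain ⟨x, hx, hx2, -⟩ := avoid 0 (-d) 0
    exact ⟨x, hx, fun h => hx2 (eq_neg_of_add_eq_zero_left h)⟩
  choose g hg0 hg1 using h1
  have key : ∀ d x : A, x ≠ 0 → x + d ≠ 0 → ψ (x + d) = ψ x * (ψ (g d + d) / ψ (g d)) := by
    intro d x hx hxd
    have := hψ (x + d) (g d) x (g d + d) hxd (hg0 d) hx (hg1 d) (by abel)
    have h0 := hψ0 _ (hg0 d)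
    field_simp
    exact this
  let χ : AddChar A ℂ :=
    { toFun := fun d => ψ (g d + d) / ψ (g d)
      map_zero_eq_one' := by
        have h0 := hψ0 _ (hg0 0)
        simp only [add_zero]
        exact div_self h0
      map_add_eq_mul' := by
        intro d e
        obtain ⟨x, hx, hx2, hx3⟩ := avoid 0 (-d) (-(d + e))
        have a1 : x + d ≠ 0 := fun h => hx2 (eq_neg_of_add_eq_zero_left h)
        have a2 : x + (d + e) ≠ 0 := fun h => hx3 (eq_neg_of_add_eq_zero_left h)
        have k1 := key _ x hx a1
        have k2 := key (d + e) x hx a2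
        have k3 := key e (x + d) a1 (by rwa [add_assoc])
        rw [add_assoc, k1, k2, mul_assoc] at k3
        exact mul_left_cancel₀ (hψ0 x hx) k3 }
  obtain ⟨x0, hx0, -⟩ := avoid 0 0 0
  refine ⟨ψ x0 * χ (-x0), mul_ne_zero (hψ0 _ hx0) (χ.val_isUnit _).ne_zero, χ, ?_⟩
  intro x hx
  have k := key (x - x0) x0 hx0 (by simpa using hx)
  rw [mul_assoc, ← AddChar.map_add_eq_mul, neg_add_eq_sub]
  rw [add_sub_cancel] at k
  exact k

/-- Solutions of the multiplicative functional equation on the punctured plane: if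
`ψ : F_q² \ {0} → ℂ^×` satisfies `ψ(x)ψ(y) = ψ(z)ψ(w)` whenever `x + y = z + w` with
all four points nonzero, then `ψ(x₁,x₂) = λ·exp((2πi/p)·Tr_n(a₁x₁+a₂x₂))` for some
`λ ∈ ℂ^×` and `(a₁,a₂) ∈ F_q²`; equivalently, `ψ` is a nonzero scalar multiple of the
restriction of an additive character of `(F_q², +)` (here `m x` is an integer lift of
`Tr_n(a₁x₁+a₂x₂) ∈ F_p ⊆ F`). -/
theorem functional_equation_on_plane (p n : ℕ) (hp : p.Prime) (hodd : Odd p)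
    (hn : 0 < n) (F : Type) [Field F] [Fintype F] [DecidableEq F]
    (hcard : Fintype.card F = p ^ n) (ψ : F × F → ℂ)
    (hψ0 : ∀ x : F × F, x ≠ 0 → ψ x ≠ 0)
    (hψ : ∀ x y z w : F × F, x ≠ 0 → y ≠ 0 → z ≠ 0 → w ≠ 0 → x + y = z + w →
      ψ x * ψ y = ψ z * ψ w) :
    (∃ lam : ℂ, lam ≠ 0 ∧ ∃ a₁ a₂ : F, ∃ m : F × F → ℕ,
      (∀ x : F × F, (m x : F) = traceN p n F (a₁ * x.1 + a₂ * x.2)) ∧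
      ∀ x : F × F, x ≠ 0 →
        ψ x = lam * Complex.exp (2 * (Real.pi : ℂ) * Complex.I * (m x : ℂ) / (p : ℂ))) ∧
    (∃ lam : ℂ, lam ≠ 0 ∧ ∃ χ : AddChar (F × F) ℂ,
      ∀ x : F × F, x ≠ 0 → ψ x = lam * χ x) := by
  have : Fact p.Prime := ⟨hp⟩
  have hq : 2 ≤ Fintype.card F := Fintype.one_lt_card
  obtain ⟨lam, hlam, χ, hχ⟩ := aux_char_exists (F × F)
    (by rw [Fintype.card_prod]; nlinarith) ψ hψ0 hψ
  refine ⟨?_, lam, hlam, χ, hχ⟩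
  have hchar : CharP F p := by
    obtain ⟨r, hr⟩ := CharP.exists F
    have hrp : r.Prime := CharP.char_is_prime F r
    obtain ⟨k, -, hk⟩ := FiniteField.card F r
    have hdvd : r ∣ p ^ n := by
      rw [← hcard, hk]; exact dvd_pow_self _ k.ne_zero
    have : r = p := (Nat.prime_dvd_prime_iff_eq hrp hp).1 (hrp.dvd_of_dvd_pow hdvd)
    exact this ▸ hr
  letI : Algebra (ZMod p) F := ZMod.algebra F p
  have hfin : Module.finrank (ZMod p) F = n := by
    have h := Module.card_eq_pow_finrank (K := ZMod p) (V := F)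
    rw [hcard, ZMod.card] at h
    exact (Nat.pow_right_injective hp.two_le h).symm
  let e : AddChar F ℂ :=
    (ZMod.stdAddChar (N := p)).compAddMonoidHom (Algebra.trace (ZMod p) F).toAddMonoidHom
  have he : ∀ x, e x = ZMod.stdAddChar (Algebra.trace (ZMod p) F x) := fun x => rfl
  have hprim : e.IsPrimitive := by
    apply AddChar.IsPrimitive.of_ne_one
    intro h
    obtain ⟨x, hx⟩ := Algebra.trace_surjective (ZMod p) F 1
    have h2 := he x
    rw [h, hx, AddChar.one_apply, ← (ZMod.stdAddChar (N := p)).map_zero_eq_one] at h2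
    exact zero_ne_one (ZMod.injective_stdAddChar h2)
  have hsurj : Function.Surjective e.mulShift :=
    ((Fintype.bijective_iff_injective_and_card _).2
      ⟨AddChar.to_mulShift_inj_of_isPrimitive hprim, AddChar.card_eq.symm⟩).2
  obtain ⟨a₁, h₁⟩ := hsurj (χ.compAddMonoidHom (AddMonoidHom.inl F F))
  obtain ⟨a₂, h₂⟩ := hsurj (χ.compAddMonoidHom (AddMonoidHom.inr F F))
  refine ⟨lam, hlam, a₁, a₂,
    fun x => (Algebra.trace (ZMod p) F (a₁ * x.1 + a₂ * x.2)).val, ?_, ?_⟩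
  · intro x
    have h := FiniteField.algebraMap_trace_eq_sum_pow (ZMod p) F (a₁ * x.1 + a₂ * x.2)
    rw [hfin, Nat.card_zmod] at h
    rw [traceN, ← h, ← map_natCast (algebraMap (ZMod p) F), ZMod.natCast_zmod_val]
  · intro x hx
    rw [hχ x hx, ← ZMod.toCircle_apply, ← ZMod.stdAddChar_apply, ← he,
      AddChar.map_add_eq_mul]
    have b1 : e (a₁ * x.1) = χ (x.1, 0) := by
      rw [← AddChar.mulShift_apply, h₁]; rfl
    have b2 : e (a₂ * x.2) = χ (0, x.2) := by
      rw [← AddChar.mulShift_apply, h₂]; rfl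
    rw [b1, b2, ← AddChar.map_add_eq_mul]
    simp
end
end
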